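/- Let (M, e, Λ) with Λ < 0 be sub-extremal Reissner–Nordström–AdS parameters with largest horizon radius r_+, α ∈ (−9/4, 0), q₀ ∈ ℝ. Define, for real-valued functions g on [r_+, ∞), the energy functional L_M[g] := ∫_{r_+}^∞ [ r²·Ω_RN²(r)·g'(r)² + ((−Λ/3)α − q₀²A_RN(r)²/Ω_RN²(r))·r²·g(r)² ] dr, where Ω_RN²(r) = 1 − 2M/r + e²/r² + (−Λ/3)r² and A_RN(r) = e(1/r_+ − 1/r). Suppose L_M[g] > 0 for every non-zero smooth g compactly supported in the open interval (r_+, ∞). Then L_M[g] ≥ 0 for every continuous compactly supported g : [r_+, ∞) → ℝ which is continuously differentiable on (r_+, ∞) except at finitely many points and for which the defining integral converges absolutely. -/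

import Mathlib

open Real Set Filter MeasureTheory

noncomputable section

/-- The Reissner–Nordström–AdS potential `Ω_RN²(r) = 1 − 2M/r + e²/r² + (−Λ/3)r²`. -/
def RNpot (Λ M e r : ℝ) : ℝ := 1 - 2*M/r + e^2/r^2 + (-Λ/3)*r^2

/-- `(M, e, Λ)` are sub-extremal parameters with largest horizon radius `rp`. -/
def IsSubExtremal (Λ M e rp : ℝ) : Prop :=
  0 < rp ∧ RNpot Λ M e rp = 0 ∧
  (∃ r0, 0 < r0 ∧ r0 ≠ rp ∧ RNpot Λ M e r0 = 0) ∧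
  ∀ r, 0 < r → RNpot Λ M e r = 0 → r ≤ rp

/-- The integrand of the energy functional `L_M`. -/
def energyIntegrand (Λ M e rp α q0 : ℝ) (g : ℝ → ℝ) (r : ℝ) : ℝ :=
  r^2 * RNpot Λ M e r * (deriv g r)^2
    + ((-Λ/3)*α - q0^2*(e*(1/rp - 1/r))^2 / RNpot Λ M e r) * r^2 * (g r)^2

/-- Cauchy–Schwarz for the integral of an `L²` function over a bounded interval. -/
theorem sq_intervalIntegral_le {D : ℝ → ℝ} (hD : MemLp D 2 volume) {x y : ℝ} (hxy : x ≤ y) :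
    (∫ t in x..y, D t) ^ 2 ≤ (y - x) * ∫ t, D t ^ 2 := by
  rcases hxy.eq_or_lt with rfl | hlt
  · simp
  have hsq : Integrable (fun t => D t ^ 2) := hD.integrable_sq
  have hsqI : IntervalIntegrable (fun t => D t ^ 2) volume x y := hsq.intervalIntegrable
  have hDI : IntervalIntegrable D volume x y := by
    rw [intervalIntegrable_iff_integrableOn_Ioc_of_le hxy]
    exact (hD.restrict _).integrable (by norm_num)
  set c : ℝ := (∫ t in x..y, D t) / (y - x) with hc
  have hpos : 0 < y - x := sub_pos.2 hlt
  have h0 : 0 ≤ ∫ t in x..y, (D t - c) ^ 2 :=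
    intervalIntegral.integral_nonneg hxy fun t _ => sq_nonneg _
  have h1 : ∫ t in x..y, (D t - c) ^ 2
      = (∫ t in x..y, D t ^ 2) - 2 * c * (∫ t in x..y, D t) + (y - x) * c ^ 2 := by
    have : (fun t => (D t - c) ^ 2) = fun t => (D t ^ 2 - 2 * c * D t) + c ^ 2 := by
      funext t; ring
    rw [this, intervalIntegral.integral_add (hsqI.sub (hDI.const_mul _)) (by simp),
      intervalIntegral.integral_sub hsqI (hDI.const_mul _), intervalIntegral.integral_const_mul,
      intervalIntegral.integral_const, smul_eq_mul]
  have h2 : ∫ t in x..y, D t ^ 2 ≤ ∫ t, D t ^ 2 := by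
    rw [intervalIntegral.integral_of_le hxy]
    exact setIntegral_le_integral hsq (Eventually.of_forall fun t => sq_nonneg _)
  have h3 : (∫ t in x..y, D t) = c * (y - x) := by rw [hc]; field_simp
  rw [h1, h3] at h0
  rw [h3]
  nlinarith

/-- Mean-zero `L²` functions supported in `[a, b]` are `L²` limits of mean-zero smooth functions
supported in a slightly larger interval. -/
theorem exists_contDiff_integral_eq_zero_approx {a b d : ℝ} (hab : a < b) (hd : 0 < d)
    {H : ℝ → ℝ} (hH : MemLp H 2 volume) (hsupp : ∀ t, t ∉ Icc a b → H t = 0)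
    (hmean : ∫ t, H t = 0) {ε : ℝ} (hε : 0 < ε) :
    ∃ Ψ : ℝ → ℝ, ContDiff ℝ (⊤ : ℕ∞) Ψ ∧ (∀ t, t ∉ Ioo (a - d) (b + d) → Ψ t = 0) ∧
      ∫ t, Ψ t = 0 ∧ MemLp Ψ 2 volume ∧ ∫ t, (Ψ t - H t) ^ 2 ≤ ε := by
  let χ : ContDiffBump ((a + b) / 2) := ⟨(b - a) / 2, (b - a) / 2 + d, by linarith, by linarith⟩
  have hχ1 : ∀ t ∈ Icc a b, χ t = 1 := fun t ht => by
    apply χ.one_of_mem_closedBall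
    rw [Real.closedBall_eq_Icc]
    change t ∈ Icc ((a + b) / 2 - (b - a) / 2) ((a + b) / 2 + (b - a) / 2)
    convert ht using 2 <;> ring
  have hball : Metric.ball ((a + b) / 2) χ.rOut = Ioo (a - d) (b + d) := by
    rw [Real.ball_eq_Ioo]
    change Ioo ((a + b) / 2 - ((b - a) / 2 + d)) ((a + b) / 2 + ((b - a) / 2 + d)) = _
    congr 1 <;> ring
  have hχ0 : ∀ t, t ∉ Ioo (a - d) (b + d) → χ t = 0 := fun t ht => by
    rw [← hball, ← χ.support_eq] at ht
    simpa using ht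
  let ρ : ℝ → ℝ := χ.normed volume
  have hρ0 : ∀ t, t ∉ Ioo (a - d) (b + d) → ρ t = 0 := fun t ht => by
    rw [← hball, ← χ.support_normed_eq (μ := volume)] at ht
    simpa using ht
  have hρL : MemLp ρ 2 volume :=
    χ.continuous_normed.memLp_of_hasCompactSupport χ.hasCompactSupport_normed
  set K : ℝ := 2 + 2 * (b - a + 2 * d) * ∫ t, ρ t ^ 2 with hK
  have hρsq : 0 ≤ ∫ t, ρ t ^ 2 := integral_nonneg fun t => sq_nonneg _
  have hKpos : 0 < K := by
    have : 0 ≤ (b - a + 2 * d) * ∫ t, ρ t ^ 2 := mul_nonneg (by linarith) hρsq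
    rw [hK]; linarith
  obtain ⟨ψ, hψc, hψs, hψ⟩ := hH.exist_eLpNorm_sub_le (by norm_num) (by norm_num)
    (Real.sqrt_pos.2 (div_pos hε hKpos))
  have hψL : MemLp ψ 2 volume := hψs.continuous.memLp_of_hasCompactSupport hψc
  have hψH : ∫ t, (H t - ψ t) ^ 2 ≤ ε / K := by
    have hm : MemLp (H - ψ) 2 volume := hH.sub hψL
    rw [hm.eLpNorm_eq_integral_rpow_norm (by norm_num) (by norm_num),
      ENNReal.ofReal_le_ofReal_iff (Real.sqrt_nonneg _)] at hψ
    simp only [ENNReal.toReal_ofNat, Real.rpow_ofNat, norm_eq_abs, sq_abs, Pi.sub_apply] at hψ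
    have h0 : 0 ≤ ∫ t, (H t - ψ t) ^ 2 := integral_nonneg fun t => sq_nonneg _
    rw [← one_div, ← Real.sqrt_eq_rpow] at hψ
    exact (Real.sqrt_le_sqrt_iff (div_pos hε hKpos).le).1 hψ
  let φ : ℝ → ℝ := fun t => χ t * ψ t
  have hφs : ContDiff ℝ (⊤ : ℕ∞) φ := χ.contDiff.mul hψs
  have hφ0 : ∀ t, t ∉ Ioo (a - d) (b + d) → φ t = 0 := fun t ht => by simp [φ, hχ0 t ht]
  have hφL : MemLp φ 2 volume :=
    hφs.continuous.memLp_of_hasCompactSupport (χ.hasCompactSupport.mul_right)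
  have hφI : Integrable φ :=
    hφs.continuous.integrable_of_hasCompactSupport (χ.hasCompactSupport.mul_right)
  have hHI : Integrable H := by
    have : IntegrableOn H (Icc a b) := (hH.restrict _).integrable (by norm_num)
    rwa [integrableOn_iff_integrable_of_support_subset] at this
    intro t ht
    by_contra h
    exact ht (hsupp t h)
  have hDL : MemLp (fun t => φ t - H t) 2 volume := hφL.sub hH
  have hDle : ∫ t, (φ t - H t) ^ 2 ≤ ε / K := by
    refine le_trans (integral_mono hDL.integrable_sq (hH.sub hψL).integrable_sq ?_) hψH
    intro t
    change (φ t - H t) ^ 2 ≤ (H t - ψ t) ^ 2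
    by_cases ht : t ∈ Icc a b
    · simp only [φ, hχ1 t ht]
      apply le_of_eq; ring
    · simp only [φ, hsupp t ht]
      have h1 := χ.nonneg (x := t)
      have h2 := χ.le_one (x := t)
      have h3 : (χ t) ^ 2 ≤ 1 := by nlinarith
      nlinarith [sq_nonneg (ψ t)]
  set c : ℝ := ∫ t, φ t with hc
  have hc2 : c ^ 2 ≤ (b - a + 2 * d) * ∫ t, (φ t - H t) ^ 2 := by
    have h1 : c = ∫ t in (a - d)..(b + d), (φ t - H t) := by
      rw [intervalIntegral.integral_eq_integral_of_support_subset, integral_sub hφI hHI, hmean,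
        sub_zero]
      intro t ht
      by_contra h
      apply ht
      change φ t - H t = 0
      rw [hφ0 t fun h' => h ⟨h'.1, h'.2.le⟩,
        hsupp t fun h' => h ⟨by linarith [h'.1], by linarith [h'.2]⟩, sub_zero]
    have h2 := sq_intervalIntegral_le hDL (show a - d ≤ b + d by linarith)
    rw [← h1] at h2
    convert h2 using 2
    ring
  refine ⟨fun t => φ t - c * ρ t, hφs.sub (contDiff_const.mul χ.contDiff_normed), ?_, ?_,
    hφL.sub (hρL.const_mul c), ?_⟩
  · intro t ht
    simp [hφ0 t ht, hρ0 t ht]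
  · rw [integral_sub hφI (χ.integrable_normed.const_mul c), integral_const_mul, χ.integral_normed]
    simp [hc]
  · have hI1 := hDL.integrable_sq
    have hI2 := hρL.integrable_sq
    calc ∫ t, (φ t - c * ρ t - H t) ^ 2
        ≤ ∫ t, (2 * (φ t - H t) ^ 2 + 2 * c ^ 2 * ρ t ^ 2) := by
          refine integral_mono ((hφL.sub (hρL.const_mul c)).sub hH).integrable_sq
            ((hI1.const_mul 2).add (hI2.const_mul _)) fun t => ?_
          change (φ t - c * ρ t - H t) ^ 2 ≤ 2 * (φ t - H t) ^ 2 + 2 * c ^ 2 * ρ t ^ 2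
          nlinarith [sq_nonneg (φ t - H t + c * ρ t)]
      _ = 2 * (∫ t, (φ t - H t) ^ 2) + 2 * c ^ 2 * ∫ t, ρ t ^ 2 := by
          rw [integral_add (hI1.const_mul 2) (hI2.const_mul _), integral_const_mul,
            integral_const_mul]
      _ ≤ K * ∫ t, (φ t - H t) ^ 2 := by
          rw [hK]
          nlinarith [mul_le_mul_of_nonneg_right hc2 hρsq]
      _ ≤ K * (ε / K) := by gcongr
      _ = ε := by field_simp

/-- A primitive of a mean-zero function vanishes outside the support interval. -/
theorem intervalIntegral_eq_zero_of_notMem_Icc {p a b : ℝ} (hpa : p < a) {K : ℝ → ℝ}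
    (hsupp : ∀ t, t ∉ Icc a b → K t = 0) (hmean : ∫ t, K t = 0) {r : ℝ} (hr : r ∉ Icc a b) :
    ∫ t in p..r, K t = 0 := by
  rcases lt_or_ge r a with h | h
  · refine (intervalIntegral.integral_congr fun t ht => hsupp t fun h' => ?_).trans
      intervalIntegral.integral_zero
    exact absurd h'.1 (not_le.2 (ht.2.trans_lt (max_lt hpa h)))
  · have hbr : b < r := lt_of_not_ge fun h' => hr ⟨h, h'⟩
    rw [intervalIntegral.integral_eq_integral_of_support_subset, hmean]
    intro t ht
    by_contra h'
    exact ht (hsupp t fun h'' => h' ⟨hpa.trans_le h''.1, h''.2.trans hbr.le⟩)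

theorem sq_le_sq_add_of_pos (x y : ℝ) {δ : ℝ} (hδ : 0 < δ) :
    |x ^ 2 - y ^ 2| ≤ δ * y ^ 2 + (1 + 1 / δ) * (x - y) ^ 2 := by
  have h : 0 ≤ (δ * y - (x - y)) ^ 2 / δ := by positivity
  have h' : 0 ≤ (δ * y + (x - y)) ^ 2 / δ := by positivity
  have e : (δ * y - (x - y)) ^ 2 / δ = δ * y ^ 2 - 2 * y * (x - y) + 1 / δ * (x - y) ^ 2 := by
    field_simp; ring
  have e' : (δ * y + (x - y)) ^ 2 / δ = δ * y ^ 2 + 2 * y * (x - y) + 1 / δ * (x - y) ^ 2 := by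
    field_simp; ring
  rw [e] at h
  rw [e'] at h'
  rw [abs_le]
  constructor <;> nlinarith [sq_nonneg (x - y)]

/-- Nonnegativity of a quadratic energy on smooth test functions extends to primitives of mean-zero
`L²` functions supported away from the endpoint. -/
theorem energy_nonneg_of_memLp_two {p a b : ℝ} {f V : ℝ → ℝ} (hf : ContinuousOn f (Ioi p))
    (hV : ContinuousOn V (Ioi p))
    (hpos : ∀ g : ℝ → ℝ, ContDiff ℝ (⊤ : ℕ∞) g → HasCompactSupport g → tsupport g ⊆ Ioi p →
      0 ≤ ∫ r in Ioi p, (f r * deriv g r ^ 2 + V r * g r ^ 2))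
    (hpa : p < a) (hab : a < b) {H : ℝ → ℝ} (hH : MemLp H 2 volume)
    (hsupp : ∀ t, t ∉ Icc a b → H t = 0) (hmean : ∫ t, H t = 0) :
    IntegrableOn (fun r => f r * H r ^ 2 + V r * (∫ t in p..r, H t) ^ 2) (Ioi p) ∧
      0 ≤ ∫ r in Ioi p, (f r * H r ^ 2 + V r * (∫ t in p..r, H t) ^ 2) := by
  set d : ℝ := (a - p) / 2 with hd
  have hd0 : 0 < d := by rw [hd]; linarith
  set J : Set ℝ := Icc (a - d) (b + d) with hJ
  have hJp : J ⊆ Ioi p := fun t ht => by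
    have := ht.1
    change p < t
    rw [hd] at this; linarith
  have hJc : IsCompact J := isCompact_Icc
  have hpa' : p < a - d := by rw [hd]; linarith
  have hsuppJ : ∀ t, t ∉ J → H t = 0 := fun t ht => hsupp t fun h =>
    ht ⟨by linarith [h.1], by linarith [h.2]⟩
  obtain ⟨C₁, hC₁⟩ := hJc.exists_bound_of_continuousOn (hf.mono hJp)
  obtain ⟨C₂, hC₂⟩ := hJc.exists_bound_of_continuousOn (hV.mono hJp)
  set C : ℝ := max (max C₁ C₂) 0 with hCdef
  have hC0 : 0 ≤ C := le_max_right _ _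
  have hfC : ∀ t ∈ J, |f t| ≤ C := fun t ht =>
    (hC₁ t ht).trans ((le_max_left _ _).trans (le_max_left _ _))
  have hVC : ∀ t ∈ J, |V t| ≤ C := fun t ht =>
    (hC₂ t ht).trans ((le_max_right _ _).trans (le_max_left _ _))
  have hII : ∀ {K : ℝ → ℝ}, MemLp K 2 volume → ∀ x y, IntervalIntegrable K volume x y := by
    intro K hK x y
    rw [intervalIntegrable_iff, uIoc]
    exact (hK.restrict _).integrable (by norm_num)
  have hcont : ∀ {K : ℝ → ℝ}, MemLp K 2 volume → Continuous fun r => ∫ t in p..r, K t :=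
    fun hK => intervalIntegral.continuous_primitive (hII hK) p
  have hintJ : ∀ {K : ℝ → ℝ}, MemLp K 2 volume →
      IntegrableOn (fun r => f r * K r ^ 2 + V r * (∫ t in p..r, K t) ^ 2) J := by
    intro K hK
    refine Integrable.add ?_ ?_
    · exact hK.integrable_sq.integrableOn.continuousOn_mul (hf.mono hJp) hJc
    · exact ((hV.mono hJp).mul ((hcont hK).pow 2).continuousOn).integrableOn_compact hJc
  have hzero : ∀ {K : ℝ → ℝ}, (∀ t, t ∉ J → K t = 0) → ∫ t, K t = 0 → ∀ r, r ∉ J →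
      f r * K r ^ 2 + V r * (∫ t in p..r, K t) ^ 2 = 0 := by
    intro K hK hK0 r hr
    rw [hK r hr, intervalIntegral_eq_zero_of_notMem_Icc hpa' hK hK0 hr]
    ring
  have hred : ∀ {K : ℝ → ℝ}, (∀ t, t ∉ J → K t = 0) → ∫ t, K t = 0 →
      ∫ r in Ioi p, (f r * K r ^ 2 + V r * (∫ t in p..r, K t) ^ 2)
        = ∫ r in J, (f r * K r ^ 2 + V r * (∫ t in p..r, K t) ^ 2) := by
    intro K hK hK0
    exact setIntegral_eq_of_subset_of_forall_sdiff_eq_zero measurableSet_Ioi hJp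
      fun r hr => hzero hK hK0 r hr.2
  refine ⟨(hintJ hH).of_forall_sdiff_eq_zero measurableSet_Ioi
    fun r hr => hzero hsuppJ hmean r hr.2, ?_⟩
  rw [hred hsuppJ hmean]
  have hGint : IntegrableOn (fun r => (∫ t in p..r, H t) ^ 2) J :=
    ((hcont hH).pow 2).continuousOn.integrableOn_compact hJc
  have hHint : IntegrableOn (fun r => H r ^ 2) J := hH.integrable_sq.integrableOn
  set N : ℝ := (∫ r in J, H r ^ 2) + ∫ r in J, (∫ t in p..r, H t) ^ 2 with hN
  have hN0 : 0 ≤ N := add_nonneg (integral_nonneg fun r => sq_nonneg _)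
    (integral_nonneg fun r => sq_nonneg _)
  set ℓ : ℝ := (b + d - p) * (b + d - (a - d)) with hℓ
  have hℓ0 : 0 ≤ ℓ := mul_nonneg (by linarith) (by linarith)
  set M : ℝ := C * (N + 1 + ℓ) with hM
  have hM0 : 0 ≤ M := by positivity
  have key : ∀ δ : ℝ, 0 < δ →
      0 ≤ (∫ r in J, (f r * H r ^ 2 + V r * (∫ t in p..r, H t) ^ 2)) + M * δ := by
    intro δ hδ
    have hε : 0 < δ ^ 2 / (1 + δ) := by positivity
    obtain ⟨Ψ, hΨs, hΨ0, hΨm, hΨL, hΨH⟩ :=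
      exists_contDiff_integral_eq_zero_approx hab hd0 hH hsupp hmean hε
    set ε : ℝ := δ ^ 2 / (1 + δ) with hεdef
    have hΨJ : ∀ t, t ∉ J → Ψ t = 0 := fun t ht => hΨ0 t fun h => ht ⟨h.1.le, h.2.le⟩
    have hder : ∀ r, HasDerivAt (fun r => ∫ t in p..r, Ψ t) (Ψ r) r := fun r =>
      (hΨs.continuous.integral_hasStrictDerivAt p r).hasDerivAt
    have hderiv : deriv (fun r => ∫ t in p..r, Ψ t) = Ψ := funext fun r => (hder r).deriv
    have hts : tsupport (fun r => ∫ t in p..r, Ψ t) ⊆ J := by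
      refine closure_minimal (fun r hr => ?_) isClosed_Icc
      by_contra h
      exact hr (intervalIntegral_eq_zero_of_notMem_Icc hpa' hΨJ hΨm h)
    have hΓ := hpos (fun r => ∫ t in p..r, Ψ t)
      (contDiff_infty_iff_deriv.2 ⟨fun r => (hder r).differentiableAt, by rwa [hderiv]⟩)
      (hJc.of_isClosed_subset (isClosed_tsupport _) hts) (hts.trans hJp)
    rw [hderiv, hred hΨJ hΨm] at hΓ
    have hDL : MemLp (fun t => Ψ t - H t) 2 volume := hΨL.sub hH
    have hDint : IntegrableOn (fun r => (Ψ r - H r) ^ 2) J := hDL.integrable_sq.integrableOn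
    have hDJ : ∫ r in J, (Ψ r - H r) ^ 2 ≤ ε :=
      (setIntegral_le_integral hDL.integrable_sq
        (Eventually.of_forall fun t => sq_nonneg _)).trans hΨH
    have hpt : ∀ r ∈ J, f r * Ψ r ^ 2 + V r * (∫ t in p..r, Ψ t) ^ 2
        ≤ (f r * H r ^ 2 + V r * (∫ t in p..r, H t) ^ 2)
          + (C * δ * (H r ^ 2 + (∫ t in p..r, H t) ^ 2)
            + (C * (1 + 1 / δ) * (Ψ r - H r) ^ 2 + C * (1 + 1 / δ) * ((b + d - p) * ε))) := by
      intro r hr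
      have h1 := sq_le_sq_add_of_pos (Ψ r) (H r) hδ
      have h2 := sq_le_sq_add_of_pos (∫ t in p..r, Ψ t) (∫ t in p..r, H t) hδ
      have h3 : ((∫ t in p..r, Ψ t) - ∫ t in p..r, H t) ^ 2 ≤ (b + d - p) * ε := by
        rw [← intervalIntegral.integral_sub (hII hΨL _ _) (hII hH _ _)]
        have hpr : p ≤ r := (hJp hr).le
        refine (sq_intervalIntegral_le hDL hpr).trans ?_
        have := hr.2
        exact mul_le_mul (by linarith) hΨH (integral_nonneg fun t => sq_nonneg _) (by linarith)
      have hq : 0 ≤ 1 + 1 / δ := by positivity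
      have h4 : f r * (Ψ r ^ 2 - H r ^ 2)
          ≤ C * (δ * H r ^ 2 + (1 + 1 / δ) * (Ψ r - H r) ^ 2) :=
        (le_abs_self _).trans (by rw [abs_mul]; exact mul_le_mul (hfC r hr) h1 (abs_nonneg _) hC0)
      have h5 : V r * ((∫ t in p..r, Ψ t) ^ 2 - (∫ t in p..r, H t) ^ 2)
          ≤ C * (δ * (∫ t in p..r, H t) ^ 2 + (1 + 1 / δ) * ((b + d - p) * ε)) :=
        (le_abs_self _).trans (by
          rw [abs_mul]
          refine mul_le_mul (hVC r hr) (h2.trans ?_) (abs_nonneg _) hC0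
          gcongr)
      linarith
    have hcst : IntegrableOn (fun _ : ℝ => C * (1 + 1 / δ) * ((b + d - p) * ε)) J :=
      continuousOn_const.integrableOn_compact hJc
    have hi3 : IntegrableOn (fun r => C * (1 + 1 / δ) * (Ψ r - H r) ^ 2
        + C * (1 + 1 / δ) * ((b + d - p) * ε)) J := (hDint.const_mul (C * (1 + 1 / δ))).add hcst
    have hi2 : IntegrableOn (fun r => C * δ * (H r ^ 2 + (∫ t in p..r, H t) ^ 2)) J :=
      (hHint.add hGint).const_mul (C * δ)
    have hi23 : IntegrableOn (fun r => C * δ * (H r ^ 2 + (∫ t in p..r, H t) ^ 2)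
        + (C * (1 + 1 / δ) * (Ψ r - H r) ^ 2 + C * (1 + 1 / δ) * ((b + d - p) * ε))) J :=
      hi2.add hi3
    have hle := setIntegral_mono_on (hintJ hΨL) ((hintJ hH).add hi23) measurableSet_Icc hpt
    have hcomp : ∫ r in J, ((f r * H r ^ 2 + V r * (∫ t in p..r, H t) ^ 2)
          + (C * δ * (H r ^ 2 + (∫ t in p..r, H t) ^ 2)
            + (C * (1 + 1 / δ) * (Ψ r - H r) ^ 2 + C * (1 + 1 / δ) * ((b + d - p) * ε))))
        = (∫ r in J, (f r * H r ^ 2 + V r * (∫ t in p..r, H t) ^ 2))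
          + (C * δ * N + (C * (1 + 1 / δ) * (∫ r in J, (Ψ r - H r) ^ 2)
            + C * (1 + 1 / δ) * (ℓ * ε))) := by
      rw [integral_add (hintJ hH) hi23]
      congr 1
      rw [integral_add hi2 hi3, integral_const_mul, integral_add hHint hGint]
      congr 1
      rw [integral_add (hDint.const_mul _) hcst, integral_const_mul, setIntegral_const]
      congr 1
      rw [hJ, Real.volume_real_Icc_of_le (by linarith), smul_eq_mul, hℓ]
      ring
    have hεδ : (1 + 1 / δ) * ε = δ := by rw [hεdef]; field_simp; ring
    have hfin : C * (1 + 1 / δ) * (∫ r in J, (Ψ r - H r) ^ 2) ≤ C * δ := by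
      calc C * (1 + 1 / δ) * (∫ r in J, (Ψ r - H r) ^ 2) ≤ C * (1 + 1 / δ) * ε := by gcongr
        _ = C * ((1 + 1 / δ) * ε) := by ring
        _ = C * δ := by rw [hεδ]
    have hfin2 : C * (1 + 1 / δ) * (ℓ * ε) = C * ℓ * δ := by
      calc C * (1 + 1 / δ) * (ℓ * ε) = C * ℓ * ((1 + 1 / δ) * ε) := by ring
        _ = C * ℓ * δ := by rw [hεδ]
    have hle' := hΓ.trans hle
    have hle'' := hle'.trans_eq hcomp
    rw [hfin2] at hle''
    rw [hM]
    linarith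
  by_contra! hneg
  set Q : ℝ := ∫ r in J, (f r * H r ^ 2 + V r * (∫ t in p..r, H t) ^ 2)
  have hδ : 0 < -Q / (M + 1) := div_pos (by linarith) (by linarith)
  have h := key _ hδ
  have h' : (M + 1) * (-Q / (M + 1)) = -Q := by field_simp
  linarith

/-- Nonnegativity of a quadratic energy on smooth test functions extends to functions which need not
vanish at the endpoint `p`, provided the leading coefficient degenerates linearly there. -/
theorem energy_nonneg_of_degenerate {p : ℝ} {f V : ℝ → ℝ} (hf : ContinuousOn f (Ioi p))
    (hV : ContinuousOn V (Ioi p)) (hf0 : ∀ r ∈ Ioi p, 0 < f r) (hV0 : ∀ r ∈ Ioi p, V r ≤ 0)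
    (hfp : ∀ R, ∃ C, ∀ r ∈ Ioc p R, f r ≤ C * (r - p))
    (hpos : ∀ g : ℝ → ℝ, ContDiff ℝ (⊤ : ℕ∞) g → HasCompactSupport g → tsupport g ⊆ Ioi p →
      0 ≤ ∫ r in Ioi p, (f r * deriv g r ^ 2 + V r * g r ^ 2))
    {g : ℝ → ℝ} (hg : ContinuousOn g (Ici p)) (hgc : HasCompactSupport g) {s : Set ℝ}
    (hs : s.Countable) (hgs : ∀ r ∈ Ioi p \ s, DifferentiableAt ℝ g r)
    (hgi : IntegrableOn (fun r => f r * deriv g r ^ 2 + V r * g r ^ 2) (Ioi p)) :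
    0 ≤ ∫ r in Ioi p, (f r * deriv g r ^ 2 + V r * g r ^ 2) := by
  obtain ⟨R, hRp, hgR⟩ : ∃ R, p + 1 < R ∧ ∀ r, R ≤ r → g r = 0 := by
    obtain ⟨B, hB⟩ := hgc.isCompact.bddAbove
    refine ⟨max (B + 1) (p + 2), lt_max_of_lt_right (by linarith), fun r hr => ?_⟩
    by_contra h
    have h1 := hB (subset_tsupport g h)
    have h2 := (le_max_left _ _).trans hr
    linarith
  have hdR : ∀ r, R < r → deriv g r = 0 := fun r hr => by
    have : g =ᶠ[nhds r] fun _ => (0 : ℝ) := by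
      filter_upwards [Ioi_mem_nhds hr] with x hx using hgR x (le_of_lt hx)
    rw [this.deriv_eq, deriv_const]
  obtain ⟨K, hK⟩ := isCompact_Icc.exists_bound_of_continuousOn
    (hg.mono (Icc_subset_Ici_self : Icc p R ⊆ Ici p))
  obtain ⟨C', hC'⟩ := hfp R
  set C : ℝ := max C' 0
  have hC0 : 0 ≤ C := le_max_right _ _
  have hC : ∀ r ∈ Ioc p R, f r ≤ C * (r - p) := fun r hr =>
    (hC' r hr).trans (mul_le_mul_of_nonneg_right (le_max_left _ _) (by linarith [hr.1]))
  have key : ∀ n : ℕ, 0 ≤ C * K ^ 2 / ((n : ℝ) + 1)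
      + ∫ r in Ioi (p + rexp (-((n : ℝ) + 1))), (f r * deriv g r ^ 2 + V r * g r ^ 2) := by
    intro n
    set L : ℝ := (n : ℝ) + 1 with hL
    have hL0 : 0 < L := by positivity
    set m : ℝ := p + rexp (-L) with hm
    set a : ℝ := p + rexp (-(2 * L)) with ha
    have hpa : p < a := by rw [ha]; linarith [exp_pos (-(2 * L))]
    have ham : a < m := by
      rw [ha, hm]
      have := exp_lt_exp.2 (show -(2 * L) < -L by linarith)
      linarith
    have hmR : m < R := by
      have := exp_lt_exp.2 (show -L < 0 by linarith)
      rw [exp_zero] at this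
      rw [hm]; linarith
    have hpm : p < m := hpa.trans ham
    have hmp : Icc m R ⊆ Ioi p := fun r hr => hpm.trans_le hr.1
    have hh2 : IntegrableOn (fun r => deriv g r ^ 2) (Icc m R) := by
      have h1 : IntegrableOn (fun r => V r * g r ^ 2) (Icc m R) :=
        ((hV.mono hmp).mul ((hg.mono (hmp.trans Ioi_subset_Ici_self)).pow 2)).integrableOn_compact
          isCompact_Icc
      have h2 := (hgi.mono_set hmp).sub h1
      have h3 := IntegrableOn.continuousOn_mul
        ((hf.mono hmp).inv₀ fun r hr => (hf0 r (hmp hr)).ne') h2 isCompact_Icc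
      refine h3.congr_fun (fun r hr => ?_) measurableSet_Icc
      have := (hf0 r (hmp hr)).ne'
      simp only [Pi.sub_apply, Pi.inv_apply]
      field_simp
      ring
    have hhL : MemLp (deriv g) 2 (volume.restrict (Ioc m R)) :=
      (memLp_two_iff_integrable_sq (measurable_deriv g).aestronglyMeasurable).2
        (hh2.mono_set Ioc_subset_Icc_self)
    have hhI : IntegrableOn (deriv g) (Ioc m R) := hhL.integrable (by norm_num)
    set κ : ℝ := g m / L with hκ
    have hkc : ContinuousOn (fun r : ℝ => κ * (r - p)⁻¹) (Icc a m) :=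
      continuousOn_const.mul ((continuousOn_id.sub continuousOn_const).inv₀ fun r hr =>
        (sub_pos.2 (hpa.trans_le hr.1)).ne')
    have hkL : MemLp (fun r : ℝ => κ * (r - p)⁻¹) 2 (volume.restrict (Ioc a m)) :=
      (memLp_two_iff_integrable_sq (by fun_prop)).2
        (((hkc.pow 2).integrableOn_compact isCompact_Icc).mono_set Ioc_subset_Icc_self)
    have hinv : ∫ r in Ioc a m, (r - p)⁻¹ = L := by
      rw [← intervalIntegral.integral_of_le ham.le,
        intervalIntegral.integral_comp_sub_right (fun x => x⁻¹) p,
        integral_inv_of_pos (by linarith) (by linarith), hm, ha, add_sub_cancel_left,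
        add_sub_cancel_left, ← exp_sub, log_exp]
      ring
    have hkI : IntegrableOn (fun r : ℝ => κ * (r - p)⁻¹) (Ioc a m) := hkL.integrable (by norm_num)
    set H : ℝ → ℝ := (Ioc m R).indicator (deriv g)
      + (Ioc a m).indicator (fun r => κ * (r - p)⁻¹) with hHdef
    have hH1 : ∀ r, m < r → r ≤ R → H r = deriv g r := fun r h1 h2 => by
      simp [hHdef, h1, h2, not_le.2 h1]
    have hH2 : ∀ r, a < r → r ≤ m → H r = κ * (r - p)⁻¹ := fun r h1 h2 => by
      simp [hHdef, h1, h2, not_lt.2 h2]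
    have hH3 : ∀ r, r ≤ a → H r = 0 := fun r h1 => by
      simp [hHdef, not_lt.2 h1, not_lt.2 (h1.trans ham.le)]
    have hH4 : ∀ r, R < r → H r = 0 := fun r h1 => by
      simp [hHdef, not_le.2 h1, not_le.2 (hmR.trans h1)]
    have hHL : MemLp H 2 volume :=
      ((memLp_indicator_iff_restrict measurableSet_Ioc).2 hhL).add
        ((memLp_indicator_iff_restrict measurableSet_Ioc).2 hkL)
    have hHI : Integrable H := ((integrable_indicator_iff measurableSet_Ioc).2 hhI).add
      ((integrable_indicator_iff measurableSet_Ioc).2 hkI)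
    have hFTC : ∀ r, m ≤ r → r ≤ R → ∫ t in r..R, deriv g t = -g r := fun r h1 h2 => by
      rw [integral_eq_of_hasDerivAt_off_countable_of_le g (deriv g) h2 hs
        (hg.mono fun x hx => (hpm.trans_le (h1.trans hx.1)).le)
        (fun x hx => (hgs x ⟨hpm.trans_le (h1.trans hx.1.1.le), hx.2⟩).hasDerivAt)
        ((intervalIntegrable_iff_integrableOn_Ioc_of_le h2).2
          (hhI.mono_set (Ioc_subset_Ioc_left h1))), hgR R le_rfl, zero_sub]
    have hmean : ∫ t, H t = 0 := by
      rw [hHdef, integral_add' ((integrable_indicator_iff measurableSet_Ioc).2 hhI)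
        ((integrable_indicator_iff measurableSet_Ioc).2 hkI), integral_indicator measurableSet_Ioc,
        integral_indicator measurableSet_Ioc, ← intervalIntegral.integral_of_le hmR.le,
        hFTC m le_rfl hmR.le, integral_const_mul, hinv, hκ]
      field_simp
      ring
    have hsupp : ∀ t, t ∉ Icc a R → H t = 0 := fun t ht => by
      rcases le_or_gt t a with h | h
      · exact hH3 t h
      · exact hH4 t (lt_of_not_ge fun h' => ht ⟨h.le, h'⟩)
    have hG : ∀ r, m ≤ r → ∫ t in p..r, H t = g r := fun r hr => by
      rcases le_or_gt r R with h | h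
      · have h1 : ∫ t in p..R, H t = 0 := by
          rw [intervalIntegral.integral_eq_integral_of_support_subset, hmean]
          intro t ht
          by_contra h'
          exact ht (hsupp t fun h'' => h' ⟨hpa.trans_le h''.1, h''.2⟩)
        have h2 : ∫ t in r..R, H t = ∫ t in r..R, deriv g t := by
          rw [intervalIntegral.integral_of_le h, intervalIntegral.integral_of_le h]
          exact setIntegral_congr_fun measurableSet_Ioc fun t ht =>
            hH1 t (hr.trans_lt ht.1) ht.2
        have h3 := intervalIntegral.integral_add_adjacent_intervals
          (hHI.intervalIntegrable (a := p) (b := r)) (hHI.intervalIntegrable (a := r) (b := R))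
        rw [h1, h2, hFTC r hr h] at h3
        linarith
      · rw [intervalIntegral_eq_zero_of_notMem_Icc hpa hsupp hmean fun h' => absurd h'.2
          (not_le.2 h), hgR r h.le]
    obtain ⟨hHint, hnonneg⟩ :=
      energy_nonneg_of_memLp_two hf hV hpos hpa (ham.trans hmR) hHL hsupp hmean
    rw [← Ioc_union_Ioi_eq_Ioi hpm.le, setIntegral_union (Ioc_disjoint_Ioi le_rfl) measurableSet_Ioi
      (hHint.mono_set Ioc_subset_Ioi_self) (hHint.mono_set (Ioi_subset_Ioi hpm.le))] at hnonneg
    have hfar : ∫ r in Ioi m, (f r * H r ^ 2 + V r * (∫ t in p..r, H t) ^ 2)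
        = ∫ r in Ioi m, (f r * deriv g r ^ 2 + V r * g r ^ 2) := by
      refine setIntegral_congr_fun measurableSet_Ioi fun r hr => ?_
      have hr' : m < r := hr
      simp only [hG r hr'.le]
      rcases le_or_gt r R with h | h
      · rw [hH1 r hr' h]
      · rw [hH4 r h, hdR r h]
    have hinvI : IntegrableOn (fun r : ℝ => (r - p)⁻¹) (Ioc a m) := by
      by_contra h
      rw [integral_undef h] at hinv
      exact hL0.ne hinv
    have hnear : ∫ r in Ioc p m, (f r * H r ^ 2 + V r * (∫ t in p..r, H t) ^ 2)
        ≤ C * K ^ 2 / L := by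
      have hbd : IntegrableOn ((Ioc a m).indicator fun r => C * κ ^ 2 * (r - p)⁻¹) (Ioc p m) :=
        ((integrable_indicator_iff measurableSet_Ioc).2 (hinvI.const_mul _)).integrableOn
      calc _ ≤ ∫ r in Ioc p m, (Ioc a m).indicator (fun r => C * κ ^ 2 * (r - p)⁻¹) r := by
            refine setIntegral_mono_on (hHint.mono_set Ioc_subset_Ioi_self) hbd measurableSet_Ioc
              fun r hr => ?_
            have hVr : V r * (∫ t in p..r, H t) ^ 2 ≤ 0 :=
              mul_nonpos_of_nonpos_of_nonneg (hV0 r hr.1) (sq_nonneg _)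
            rcases le_or_gt r a with h | h
            · rw [hH3 r h, indicator_of_notMem fun h' => absurd h'.1 (not_lt.2 h)]
              linarith
            · rw [hH2 r h hr.2, indicator_of_mem (show r ∈ Ioc a m from ⟨h, hr.2⟩)]
              have hrp : 0 < r - p := sub_pos.2 hr.1
              have h1 := mul_le_mul_of_nonneg_right (hC r ⟨hr.1, hr.2.trans hmR.le⟩)
                (sq_nonneg (κ * (r - p)⁻¹))
              have h2 : C * (r - p) * (κ * (r - p)⁻¹) ^ 2 = C * κ ^ 2 * (r - p)⁻¹ := by
                field_simp
              linarith
        _ = C * κ ^ 2 * L := by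
            rw [setIntegral_indicator measurableSet_Ioc,
              inter_eq_right.2 (Ioc_subset_Ioc_left hpa.le), integral_const_mul, hinv]
        _ = C * g m ^ 2 / L := by rw [hκ]; field_simp
        _ ≤ C * K ^ 2 / L := by
            have h1 : |g m| ≤ K := hK m ⟨hpm.le, hmR.le⟩
            have h2 : g m ^ 2 ≤ K ^ 2 := sq_le_sq' (by linarith [neg_abs_le (g m)])
              ((le_abs_self _).trans h1)
            gcongr
    rw [hfar] at hnonneg
    linarith
  have hunion : ⋃ n : ℕ, Ioi (p + rexp (-((n : ℝ) + 1))) = Ioi p := by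
    ext r
    simp only [mem_iUnion, mem_Ioi]
    constructor
    · rintro ⟨n, hn⟩
      linarith [exp_pos (-((n : ℝ) + 1))]
    · intro hr
      obtain ⟨n, hn⟩ := exists_nat_gt (-log (r - p))
      refine ⟨n, ?_⟩
      have h := (lt_log_iff_exp_lt (sub_pos.2 hr)).1 (show -((n : ℝ) + 1) < log (r - p) by linarith)
      linarith
  have hlim := tendsto_setIntegral_of_monotone (μ := volume)
    (f := fun r => f r * deriv g r ^ 2 + V r * g r ^ 2)
    (s := fun n : ℕ => Ioi (p + rexp (-((n : ℝ) + 1)))) (fun _ => measurableSet_Ioi)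
    (fun i j hij => Ioi_subset_Ioi (by
      have : (i : ℝ) ≤ j := by exact_mod_cast hij
      gcongr)) (by rwa [hunion])
  rw [hunion] at hlim
  have h0 : Tendsto (fun n : ℕ => C * K ^ 2 / ((n : ℝ) + 1)) atTop (nhds 0) :=
    tendsto_const_nhds.div_atTop (tendsto_natCast_atTop_atTop.atTop_add tendsto_const_nhds)
  have := ge_of_tendsto' (h0.add hlim) key
  simpa using this

theorem RNpot_factorization {Λ M e rp r0 : ℝ} (hrp : 0 < rp) (h0 : 0 < r0) (hne : r0 ≠ rp)
    (hp : RNpot Λ M e rp = 0) (hz : RNpot Λ M e r0 = 0) {r : ℝ} (hr : 0 < r) :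
    r ^ 2 * RNpot Λ M e r = (r - rp) * ((r - r0) *
      (1 + -Λ / 3 * (r ^ 2 + rp ^ 2 + r0 ^ 2 + r * rp + r * r0 + rp * r0))) := by
  have hpoly : ∀ x : ℝ, 0 < x →
      x ^ 2 * RNpot Λ M e x = -Λ / 3 * x ^ 4 + x ^ 2 - 2 * M * x + e ^ 2 := by
    intro x hx
    rw [RNpot]
    field_simp
    ring
  have h1 := hpoly rp hrp
  have h2 := hpoly r0 h0
  rw [hp, mul_zero] at h1
  rw [hz, mul_zero] at h2
  have hM : 2 * M = -Λ / 3 * (rp ^ 3 + rp ^ 2 * r0 + rp * r0 ^ 2 + r0 ^ 3) + (rp + r0) :=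
    mul_left_cancel₀ (sub_ne_zero.2 hne) (by linear_combination h2 - h1)
  rw [hpoly r hr]
  linear_combination (rp - r) * hM - h1

theorem stmt_18 (Λ M e rp α q0 : ℝ) (hΛ : Λ < 0)
    (hsub : IsSubExtremal Λ M e rp) (hα : α ∈ Ioo (-(9:ℝ)/4) 0)
    (L : (ℝ → ℝ) → ℝ)
    (hL : ∀ g, L g = ∫ r in Ioi rp, energyIntegrand Λ M e rp α q0 g r)
    -- positivity of L on nonzero smooth functions compactly supported in (r_+, ∞)
    (hpos : ∀ g : ℝ → ℝ, ContDiff ℝ (⊤ : ℕ∞) g → HasCompactSupport g →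
      tsupport g ⊆ Ioi rp → g ≠ 0 → 0 < L g) :
    ∀ g : ℝ → ℝ,
      -- g : [r_+, ∞) → ℝ continuous and compactly supported
      ContinuousOn g (Ici rp) → HasCompactSupport g → tsupport g ⊆ Ici rp →
      -- continuously differentiable on (r_+, ∞) except at finitely many points
      (∃ s : Finset ℝ, ∀ r ∈ Ioi rp \ (s : Set ℝ),
        DifferentiableAt ℝ g r ∧ ContinuousAt (deriv g) r) →
      -- the defining integral converges absolutely
      IntegrableOn (energyIntegrand Λ M e rp α q0 g) (Ioi rp) →
      0 ≤ L g := by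
  intro g hg hgc _ hgs hgi
  obtain ⟨s, hs⟩ := hgs
  obtain ⟨hrp, hp, ⟨r0, h0, hne, hz⟩, hmax⟩ := hsub
  have hlt : r0 < rp := lt_of_le_of_ne (hmax r0 h0 hz) hne
  have hk : 0 < -Λ / 3 := by linarith
  have hfac := fun (r : ℝ) (hr : 0 < r) => RNpot_factorization hrp h0 hne hp hz hr
  have hΩ : ∀ r ∈ Ioi rp, 0 < RNpot Λ M e r := fun r hr => by
    have hr' : rp < r := hr
    have hr0 : 0 < r := hrp.trans hr'
    have h1 : 0 < r ^ 2 * RNpot Λ M e r := by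
      rw [hfac r hr0]
      have := sub_pos.2 hr'
      have := sub_pos.2 (hlt.trans hr')
      positivity
    exact pos_of_mul_pos_right h1 (sq_nonneg r)
  have hne0 : ∀ r ∈ Ioi rp, r ≠ 0 := fun r hr => (hrp.trans hr).ne'
  have hΩc : ContinuousOn (RNpot Λ M e) (Ioi rp) := by
    intro r hr
    have h1 : r ≠ 0 := hne0 r hr
    have h2 : r ^ 2 ≠ 0 := pow_ne_zero 2 h1
    refine ContinuousAt.continuousWithinAt ?_
    unfold RNpot
    fun_prop (disch := assumption)
  let f : ℝ → ℝ := fun r => r ^ 2 * RNpot Λ M e r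
  let V : ℝ → ℝ := fun r =>
    ((-Λ / 3) * α - q0 ^ 2 * (e * (1 / rp - 1 / r)) ^ 2 / RNpot Λ M e r) * r ^ 2
  rw [hL]
  refine energy_nonneg_of_degenerate (p := rp) (f := f) (V := V) ?_ ?_ ?_ ?_ ?_ ?_ hg hgc
    s.countable_toSet (fun r hr => (hs r hr).1) hgi
  · exact (continuousOn_id.pow 2).mul hΩc
  · have hinv : ContinuousOn (fun r : ℝ => 1 / r) (Ioi rp) :=
      continuousOn_const.div continuousOn_id hne0
    exact (continuousOn_const.sub ((continuousOn_const.mul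
      ((continuousOn_const.mul (continuousOn_const.sub hinv)).pow 2)).div hΩc
        fun r hr => (hΩ r hr).ne')).mul (continuousOn_id.pow 2)
  · intro r hr
    have := hΩ r hr
    have := hrp.trans hr
    positivity
  · intro r hr
    have h1 : -Λ / 3 * α ≤ 0 := mul_nonpos_of_nonneg_of_nonpos hk.le hα.2.le
    have h2 : 0 ≤ q0 ^ 2 * (e * (1 / rp - 1 / r)) ^ 2 / RNpot Λ M e r :=
      div_nonneg (by positivity) (hΩ r hr).le
    exact mul_nonpos_of_nonpos_of_nonneg (by linarith) (sq_nonneg r)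
  · intro R
    have hq : Continuous fun r : ℝ => (r - r0) *
        (1 + -Λ / 3 * (r ^ 2 + rp ^ 2 + r0 ^ 2 + r * rp + r * r0 + rp * r0)) := by fun_prop
    obtain ⟨C, hC⟩ := isCompact_Icc.exists_bound_of_continuousOn (s := Icc rp R) hq.continuousOn
    refine ⟨C, fun r hr => ?_⟩
    change r ^ 2 * RNpot Λ M e r ≤ _
    rw [hfac r (hrp.trans hr.1), mul_comm C]
    exact mul_le_mul_of_nonneg_left ((le_abs_self _).trans (hC r ⟨hr.1.le, hr.2⟩))
      (sub_pos.2 hr.1).le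
  · intro φ hφ hφc hφs
    rcases eq_or_ne φ 0 with rfl | h
    · simp
    · have := hpos φ hφ hφc hφs h
      rw [hL] at this
      exact this.le
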